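/- arXiv:2208.11245 — 4 statements merged into one kernel-verified Lean document; each statement's English description precedes it below -/
import Mathlib

section
/- Let Ω ⊆ ℝ^N be Lebesgue measurable with |Ω| < ∞ and let T > 0 be fixed. Then for every s ∈ ℂ with Re s > dim̄_B(∞,Ω), the distance and tube zeta functions of Ω at infinity are given by absolutely convergent integrals and satisfy the functional equation ζ_{∞,Ω}(s;T) = T^{-s-N}·|_TΩ| − (s+N)·ζ̃_{∞,Ω}(s;T), i.e. ∫_{B_T(0)^c ∩ Ω} |x|^{-s-N} dx = T^{-s-N}|_TΩ| − (s+N)∫_T^{+∞} t^{-s-N-1}|_tΩ| dt. -/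
open MeasureTheory Filter Set Complex Topology
open scoped ENNReal Real

noncomputable section

/-- The "tail" of `Ω` beyond radius `t`: the complement of the open Euclidean ball of
radius `t` centered at `0`, intersected with `Ω`. -/
def tailSet (N : ℕ) (Ω : Set (EuclideanSpace ℝ (Fin N))) (t : ℝ) :
    Set (EuclideanSpace ℝ (Fin N)) :=
  {x | x ∈ Ω ∧ t ≤ ‖x‖}

/-- The tube function `t ↦ |_tΩ|` at infinity. -/
def tubeVol (N : ℕ) (Ω : Set (EuclideanSpace ℝ (Fin N))) (t : ℝ) : ℝ :=
  (volume (tailSet N Ω t)).toReal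

/-- Upper `r`-dimensional Minkowski content of `Ω` at infinity. -/
def upperMinkContent (N : ℕ) (Ω : Set (EuclideanSpace ℝ (Fin N))) (r : ℝ) : ℝ≥0∞ :=
  Filter.limsup (fun t : ℝ => volume (tailSet N Ω t) / ENNReal.ofReal (t ^ ((N : ℝ) + r)))
    Filter.atTop

/-- Lower `r`-dimensional Minkowski content of `Ω` at infinity. -/
def lowerMinkContent (N : ℕ) (Ω : Set (EuclideanSpace ℝ (Fin N))) (r : ℝ) : ℝ≥0∞ :=
  Filter.liminf (fun t : ℝ => volume (tailSet N Ω t) / ENNReal.ofReal (t ^ ((N : ℝ) + r)))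
    Filter.atTop

/-- Upper Minkowski dimension of `Ω` at infinity. -/
def upperMinkDim (N : ℕ) (Ω : Set (EuclideanSpace ℝ (Fin N))) : ℝ :=
  sInf {r : ℝ | upperMinkContent N Ω r = 0}

/-- Lower Minkowski dimension of `Ω` at infinity. -/
def lowerMinkDim (N : ℕ) (Ω : Set (EuclideanSpace ℝ (Fin N))) : ℝ :=
  sInf {r : ℝ | lowerMinkContent N Ω r = 0}

/-- Distance (Lapidus) zeta function of `Ω` at infinity. -/
def distZeta (N : ℕ) (Ω : Set (EuclideanSpace ℝ (Fin N))) (T : ℝ) (s : ℂ) : ℂ :=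
  ∫ x in tailSet N Ω T, (‖x‖ : ℂ) ^ (-s - (N : ℂ))

/-- Tube zeta function of `Ω` at infinity. -/
def tubeZeta (N : ℕ) (Ω : Set (EuclideanSpace ℝ (Fin N))) (T : ℝ) (s : ℂ) : ℂ :=
  ∫ t in Set.Ioi T, (t : ℂ) ^ (-s - (N : ℂ) - 1) * ((tubeVol N Ω t : ℝ) : ℂ)

/-- Abscissa of (absolute) convergence of the distance zeta function at infinity. -/
def distAbscissa (N : ℕ) (Ω : Set (EuclideanSpace ℝ (Fin N))) (T : ℝ) : ℝ :=
  sInf {σ : ℝ | ∀ s : ℂ, σ < s.re →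
    IntegrableOn (fun x => (‖x‖ : ℂ) ^ (-s - (N : ℂ))) (tailSet N Ω T) volume}

/-- Abscissa of (absolute) convergence of the tube zeta function at infinity. -/
def tubeAbscissa (N : ℕ) (Ω : Set (EuclideanSpace ℝ (Fin N))) (T : ℝ) : ℝ :=
  sInf {σ : ℝ | ∀ s : ℂ, σ < s.re →
    IntegrableOn (fun t : ℝ => (t : ℂ) ^ (-s - (N : ℂ) - 1) * ((tubeVol N Ω t : ℝ) : ℂ))
      (Set.Ioi T) volume}

/-- Complex layer-cake formula: for a measurable `f` with values in `[T, ∞)` on a finite measure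
space, the integral of `f ^ w` is expressed through the tails `t ↦ μ {t ≤ f}`. -/
theorem integrable_cpow_and_integral_cpow_eq_of_tail {α : Type*} [MeasurableSpace α]
    {μ : Measure α} [IsFiniteMeasure μ] {f : α → ℝ} (hf : Measurable f) {T : ℝ} (hT : 0 < T)
    (hTf : ∀ᵐ x ∂μ, T ≤ f x) (w : ℂ)
    (hint : IntegrableOn (fun t : ℝ => (t : ℂ) ^ (w - 1) * (μ.real {x | t ≤ f x} : ℂ)) (Ioi T)) :
    Integrable (fun x => (f x : ℂ) ^ w) μ ∧
      ∫ x, (f x : ℂ) ^ w ∂μ = (T : ℂ) ^ w * (μ.real univ : ℂ)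
        + w * ∫ t in Ioi T, (t : ℂ) ^ (w - 1) * (μ.real {x | t ≤ f x} : ℂ) := by
  set S : Set (α × ℝ) := {p | p.2 ≤ f p.1} with hS
  have hSmeas : MeasurableSet S := measurableSet_le measurable_snd (hf.comp measurable_fst)
  set F : α × ℝ → ℂ := S.indicator fun p => (p.2 : ℂ) ^ (w - 1) with hF
  have hFmeas : Measurable F :=
    ((Complex.measurable_ofReal.comp measurable_snd).pow_const _).indicator hSmeas
  have hsec (t : ℝ) : MeasurableSet {x | t ≤ f x} := measurableSet_le measurable_const hf
  have hFt (t : ℝ) : (fun x => F (x, t)) = {x | t ≤ f x}.indicator fun _ => (t : ℂ) ^ (w - 1) := by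
    ext x
    simp [hF, hS, indicator_apply]
  have hFx (x : α) : (fun t => F (x, t)) = (Iic (f x)).indicator fun t => (t : ℂ) ^ (w - 1) := by
    ext t
    simp [hF, hS, indicator_apply]
  have hintF : Integrable F (μ.prod (volume.restrict (Ioi T))) := by
    rw [integrable_prod_iff' hFmeas.aestronglyMeasurable]
    refine ⟨ae_of_all _ fun t => ?_, ?_⟩
    · rw [hFt]
      exact (integrable_const _).indicator (hsec t)
    · refine hint.norm.congr (ae_of_all _ fun t => ?_)
      have h : (fun x => ‖F (x, t)‖) =
          {x | t ≤ f x}.indicator fun _ => ‖(t : ℂ) ^ (w - 1)‖ := by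
        ext x
        rw [congrFun (hFt t) x, norm_indicator_eq_indicator_norm]
      simp only [h, integral_indicator_const _ (hsec t), norm_mul, Complex.norm_real,
        Real.norm_of_nonneg measureReal_nonneg, smul_eq_mul, mul_comm]
  have hftc : ∀ᵐ x ∂μ,
      (T : ℂ) ^ w + w * ∫ t in Ioi T, F (x, t) = (f x : ℂ) ^ w := by
    filter_upwards [hTf] with x hx
    rw [hFx, setIntegral_indicator measurableSet_Iic, Ioi_inter_Iic,
      ← intervalIntegral.integral_of_le hx]
    rcases eq_or_ne w 0 with rfl | hw
    · simp
    · have h0 : (0 : ℝ) ∉ uIcc T (f x) := by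
        rw [uIcc_of_le hx]
        exact fun h => absurd h.1 (not_le.2 hT)
      rw [integral_cpow (Or.inr ⟨fun h => hw (by linear_combination h), h0⟩), sub_add_cancel]
      field_simp
      ring
  have hI := (hintF.integral_prod_left).const_mul w
  refine ⟨((integrable_const ((T : ℂ) ^ w)).add hI).congr hftc, ?_⟩
  rw [← integral_congr_ae hftc, integral_add (integrable_const _) hI, integral_const,
    integral_const_mul, integral_integral_swap (f := fun x t => F (x, t)) hintF]
  congr 2
  · rw [Complex.real_smul, mul_comm]
  · refine integral_congr_ae (ae_of_all _ fun t => ?_)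
    simp only [hFt, integral_indicator_const _ (hsec t), Complex.real_smul, mul_comm]

theorem tailSet_antitone (N : ℕ) (Ω : Set (EuclideanSpace ℝ (Fin N))) :
    Antitone (tailSet N Ω) :=
  fun _ _ h _ hx => ⟨hx.1, h.trans hx.2⟩

theorem tailSet_subset (N : ℕ) (Ω : Set (EuclideanSpace ℝ (Fin N))) (t : ℝ) :
    tailSet N Ω t ⊆ Ω :=
  fun _ hx => hx.1

theorem measurableSet_tailSet {N : ℕ} {Ω : Set (EuclideanSpace ℝ (Fin N))}
    (hmeas : MeasurableSet Ω) (t : ℝ) : MeasurableSet (tailSet N Ω t) :=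
  hmeas.inter (measurableSet_le measurable_const measurable_norm)

theorem tubeVol_nonneg (N : ℕ) (Ω : Set (EuclideanSpace ℝ (Fin N))) (t : ℝ) :
    0 ≤ tubeVol N Ω t :=
  ENNReal.toReal_nonneg

theorem tubeVol_antitone {N : ℕ} {Ω : Set (EuclideanSpace ℝ (Fin N))} (hfin : volume Ω < ⊤) :
    Antitone (tubeVol N Ω) :=
  fun _ _ h => ENNReal.toReal_mono ((measure_mono (tailSet_subset N Ω _)).trans_lt hfin).ne
    (measure_mono (tailSet_antitone N Ω h))

theorem upperMinkContent_eq_zero_of_pos {N : ℕ} {Ω : Set (EuclideanSpace ℝ (Fin N))}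
    (hfin : volume Ω < ⊤) {r : ℝ} (hr : 0 < N + r) : upperMinkContent N Ω r = 0 := by
  have hlim : Tendsto (fun t : ℝ => volume Ω / ENNReal.ofReal (t ^ ((N : ℝ) + r))) atTop (𝓝 0) := by
    have h := ENNReal.Tendsto.const_div
      (ENNReal.tendsto_ofReal_atTop.comp (tendsto_rpow_atTop hr)) (Or.inr hfin.ne)
    simpa using h
  exact (tendsto_of_tendsto_of_tendsto_of_le_of_le tendsto_const_nhds hlim (fun _ => zero_le)
    fun t => ENNReal.div_le_div_right (measure_mono (tailSet_subset N Ω t)) _).limsup_eq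

theorem exists_upperMinkContent_eq_zero_of_upperMinkDim_lt {N : ℕ}
    {Ω : Set (EuclideanSpace ℝ (Fin N))} (hfin : volume Ω < ⊤) {σ : ℝ}
    (hσ : upperMinkDim N Ω < σ) : ∃ r < σ, upperMinkContent N Ω r = 0 := by
  by_cases hb : BddBelow {r : ℝ | upperMinkContent N Ω r = 0}
  · obtain ⟨r, hr, hrσ⟩ := exists_lt_of_csInf_lt
      ⟨1, upperMinkContent_eq_zero_of_pos hfin (by positivity)⟩ hσ
    exact ⟨r, hrσ, hr⟩
  · obtain ⟨r, hr, hrσ⟩ := not_bddBelow_iff.1 hb σ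
    exact ⟨r, hrσ, hr⟩

theorem eventually_tubeVol_le_rpow {N : ℕ} {Ω : Set (EuclideanSpace ℝ (Fin N))} {r : ℝ}
    (hr : upperMinkContent N Ω r = 0) : ∀ᶠ t in atTop, tubeVol N Ω t ≤ t ^ ((N : ℝ) + r) := by
  have hlt := eventually_lt_of_limsup_lt (hr.trans_lt one_pos)
  filter_upwards [hlt, eventually_gt_atTop 0] with t ht ht0
  have hpos : 0 < t ^ ((N : ℝ) + r) := Real.rpow_pos_of_pos ht0 _
  refine ENNReal.toReal_le_of_le_ofReal hpos.le ?_
  have h := (ENNReal.div_le_iff (ENNReal.ofReal_pos.2 hpos).ne' ENNReal.ofReal_ne_top).1 ht.le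
  rwa [one_mul] at h

theorem integrableOn_cpow_mul_tubeVol {N : ℕ} {Ω : Set (EuclideanSpace ℝ (Fin N))}
    (hfin : volume Ω < ⊤) {T : ℝ} (hT : 0 < T) {s : ℂ} (hs : upperMinkDim N Ω < s.re) :
    IntegrableOn (fun t : ℝ => (t : ℂ) ^ (-s - (N : ℂ) - 1) * ((tubeVol N Ω t : ℝ) : ℂ))
      (Ioi T) := by
  obtain ⟨r, hrs, hr⟩ := exists_upperMinkContent_eq_zero_of_upperMinkDim_lt hfin hs
  obtain ⟨R, hR⟩ := eventually_atTop.1 (eventually_tubeVol_le_rpow hr)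
  have hTR : T ≤ max T R := le_max_left T R
  have hpos : 0 < max T R := hT.trans_le hTR
  have hmeas : Measurable
      (fun t : ℝ => (t : ℂ) ^ (-s - (N : ℂ) - 1) * ((tubeVol N Ω t : ℝ) : ℂ)) :=
    (Complex.measurable_ofReal.pow_const _).mul
      (Complex.measurable_ofReal.comp (tubeVol_antitone hfin).measurable)
  rw [← Ioc_union_Ioi_eq_Ioi hTR]
  refine IntegrableOn.union ?_ ?_
  · have hcpow : IntegrableOn (fun t : ℝ => (t : ℂ) ^ (-s - (N : ℂ) - 1)) (Ioc T (max T R)) := by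
      refine (intervalIntegrable_iff_integrableOn_Ioc_of_le hTR).1
        (intervalIntegral.intervalIntegrable_cpow (Or.inr ?_))
      rw [uIcc_of_le hTR]
      exact fun h => absurd h.1 (not_le.2 hT)
    refine (hcpow.norm.mul_const (tubeVol N Ω T)).mono' hmeas.aestronglyMeasurable ?_
    filter_upwards [ae_restrict_mem measurableSet_Ioc] with t ht
    rw [norm_mul, Complex.norm_real, Real.norm_of_nonneg (tubeVol_nonneg N Ω t)]
    exact mul_le_mul_of_nonneg_left (tubeVol_antitone hfin ht.1.le) (norm_nonneg _)
  · refine (integrableOn_Ioi_rpow_of_lt (a := r - s.re - 1) (by linarith) hpos).mono'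
      hmeas.aestronglyMeasurable ?_
    filter_upwards [ae_restrict_mem measurableSet_Ioi] with t ht
    have ht0 : 0 < t := hpos.trans ht
    rw [norm_mul, Complex.norm_real, Real.norm_of_nonneg (tubeVol_nonneg N Ω t),
      Complex.norm_cpow_eq_rpow_re_of_pos ht0]
    calc t ^ (-s - (N : ℂ) - 1).re * tubeVol N Ω t
        ≤ t ^ (-s - (N : ℂ) - 1).re * t ^ ((N : ℝ) + r) :=
          mul_le_mul_of_nonneg_left (hR t ((le_max_right T R).trans ht.le))
            (Real.rpow_nonneg ht0.le _)
      _ = t ^ (r - s.re - 1) := by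
          rw [← Real.rpow_add ht0]
          congr 1
          simp
          ring

/-- functional equation between the distance and tube zeta functions at
infinity, together with absolute convergence of both defining integrals on the half-plane
`{Re s > dim̄_B(∞,Ω)}`. -/
theorem functional_equation_dist_tube_zeta_at_infinity
    (N : ℕ) (Ω : Set (EuclideanSpace ℝ (Fin N)))
    (hmeas : MeasurableSet Ω) (hfin : volume Ω < ⊤)
    (T : ℝ) (hT : 0 < T)
    (s : ℂ) (hs : upperMinkDim N Ω < s.re) :
    IntegrableOn (fun x => (‖x‖ : ℂ) ^ (-s - (N : ℂ))) (tailSet N Ω T) volume ∧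
    IntegrableOn (fun t : ℝ => (t : ℂ) ^ (-s - (N : ℂ) - 1) * ((tubeVol N Ω t : ℝ) : ℂ))
      (Set.Ioi T) volume ∧
    distZeta N Ω T s
      = (T : ℂ) ^ (-s - (N : ℂ)) * ((tubeVol N Ω T : ℝ) : ℂ)
        - (s + (N : ℂ)) * tubeZeta N Ω T s := by
  have htube := integrableOn_cpow_mul_tubeVol hfin hT hs
  have hmeasT := measurableSet_tailSet hmeas T
  have : IsFiniteMeasure (volume.restrict (tailSet N Ω T)) :=
    isFiniteMeasure_restrict.2 ((measure_mono (tailSet_subset N Ω T)).trans_lt hfin).ne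
  have hvol : ∀ t ∈ Ioi T,
      (volume.restrict (tailSet N Ω T)).real {x | t ≤ ‖x‖} = tubeVol N Ω t := by
    intro t ht
    rw [measureReal_restrict_apply (measurableSet_le measurable_const measurable_norm)]
    refine congrArg (fun A => (volume A).toReal) (Set.ext fun x => ?_)
    exact ⟨fun h => ⟨h.2.1, h.1⟩, fun h => ⟨h.2, h.1, (le_of_lt ht).trans h.2⟩⟩
  have heq : EqOn (fun t : ℝ => (t : ℂ) ^ (-s - (N : ℂ) - 1) * ((tubeVol N Ω t : ℝ) : ℂ))
      (fun t : ℝ => (t : ℂ) ^ (-s - (N : ℂ) - 1) *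
        ((volume.restrict (tailSet N Ω T)).real {x | t ≤ ‖x‖} : ℂ)) (Ioi T) :=
    fun t ht => by simp only [hvol t ht]
  have hnorm : ∀ᵐ x ∂volume.restrict (tailSet N Ω T), T ≤ ‖x‖ := by
    filter_upwards [ae_restrict_mem hmeasT] with x hx using hx.2
  obtain ⟨hdist, hformula⟩ := integrable_cpow_and_integral_cpow_eq_of_tail measurable_norm hT hnorm
    (-s - (N : ℂ)) (htube.congr_fun heq measurableSet_Ioi)
  refine ⟨hdist, htube, ?_⟩
  rw [distZeta, hformula, ← setIntegral_congr_fun measurableSet_Ioi heq, tubeZeta, tubeVol,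
    measureReal_restrict_apply_univ, measureReal_def]
  ring
end
end

section
/- Let Ω ⊆ ℝ^N be Lebesgue measurable with |Ω| < ∞, let D̄ := dim̄_B(∞,Ω), and let T > 0. Then for every s ∈ ℂ with Re s > D̄ the integral ∫_T^{+∞} t^{-Re s - N - 1}|_tΩ| dt is finite; consequently the tube zeta function at infinity ζ̃_{∞,Ω}(s;T) = ∫_T^{+∞} t^{-s-N-1}|_tΩ| dt is well defined and holomorphic on the open half-plane {Re s > D̄}. Moreover, for every ε > 0 with Re s > D̄ + ε there is a constant C_T > 0 (depending only on T and ε, with |_tΩ| ≤ C_T t^{N+D̄+ε} for all t > T) such that |ζ̃_{∞,Ω}(s;T)| ≤ C_T · T^{D̄+ε−Re s}/(Re s − D̄ − ε). -/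
open MeasureTheory Filter Set Complex Topology
open scoped ENNReal Real

noncomputable section

theorem volume_tailSet_le (N : ℕ) (Ω : Set (EuclideanSpace ℝ (Fin N))) (t : ℝ) :
    volume (tailSet N Ω t) ≤ volume Ω :=
  measure_mono fun _ hx => hx.1

/-- For `r` above the upper Minkowski dimension, the tube function is eventually at most `t ^ (N + r)`.
This also holds when every real exponent has zero content, where `sInf` takes its default value. -/
theorem eventually_tubeVol_le {N : ℕ} {Ω : Set (EuclideanSpace ℝ (Fin N))}
    (hfin : volume Ω < ⊤) {r : ℝ} (hr : upperMinkDim N Ω < r) :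
    ∀ᶠ t in atTop, tubeVol N Ω t ≤ t ^ ((N : ℝ) + r) := by
  have hne : {r : ℝ | upperMinkContent N Ω r = 0}.Nonempty :=
    ⟨1, upperMinkContent_eq_zero_of_pos hfin (by positivity)⟩
  obtain ⟨q, hq, hqr⟩ := exists_lt_of_csInf_lt hne hr
  have hlt : upperMinkContent N Ω q < 1 := by
    rw [show upperMinkContent N Ω q = 0 from hq]
    exact one_pos
  filter_upwards [eventually_lt_of_limsup_lt hlt, eventually_ge_atTop 1] with t ht ht1
  have hpos : 0 < t ^ ((N : ℝ) + q) := Real.rpow_pos_of_pos (by linarith) _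
  have hle : volume (tailSet N Ω t) ≤ ENNReal.ofReal (t ^ ((N : ℝ) + q)) := by
    simpa using (ENNReal.div_le_iff (ENNReal.ofReal_pos.2 hpos).ne' ENNReal.ofReal_ne_top).1 ht.le
  exact (ENNReal.toReal_le_of_le_ofReal hpos.le hle).trans
    (Real.rpow_le_rpow_of_exponent_le ht1 (by linarith))

theorem exists_tubeVol_le {N : ℕ} {Ω : Set (EuclideanSpace ℝ (Fin N))}
    (hfin : volume Ω < ⊤) {T r : ℝ} (hT : 0 < T) (hr : upperMinkDim N Ω < r) :
    ∃ C : ℝ, 0 < C ∧ ∀ t : ℝ, T < t → tubeVol N Ω t ≤ C * t ^ ((N : ℝ) + r) := by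
  obtain ⟨R, hR⟩ := eventually_atTop.1 (eventually_tubeVol_le hfin hr)
  have hcont : ContinuousOn (fun t : ℝ => tubeVol N Ω T / t ^ ((N : ℝ) + r)) (Icc T R) :=
    continuousOn_const.div
      (fun t ht => (Real.continuousAt_rpow_const t _
        (Or.inl (hT.trans_le ht.1).ne')).continuousWithinAt)
      fun t ht => (Real.rpow_pos_of_pos (hT.trans_le ht.1) _).ne'
  obtain ⟨K, hK⟩ := isCompact_Icc.bddAbove_image hcont
  refine ⟨max 1 K, by positivity, fun t ht => ?_⟩
  have hpos : 0 < t ^ ((N : ℝ) + r) := Real.rpow_pos_of_pos (hT.trans ht) _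
  rcases le_total R t with h | h
  · exact (hR t h).trans (le_mul_of_one_le_left hpos.le (le_max_left _ _))
  · calc tubeVol N Ω t ≤ tubeVol N Ω T := tubeVol_antitone hfin ht.le
      _ ≤ K * t ^ ((N : ℝ) + r) := (div_le_iff₀ hpos).1 (hK ⟨t, ⟨ht.le, h⟩, rfl⟩)
      _ ≤ max 1 K * t ^ ((N : ℝ) + r) := by gcongr; exact le_max_right _ _

/-- The tube function cut off to `(T, ∞)`, whose Mellin transform is the tube zeta function. -/
def truncatedTube (N : ℕ) (Ω : Set (EuclideanSpace ℝ (Fin N))) (T : ℝ) : ℝ → ℂ :=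
  (Ioi T).indicator fun t => (tubeVol N Ω t : ℂ)

theorem truncatedTube_locallyIntegrable {N : ℕ} {Ω : Set (EuclideanSpace ℝ (Fin N))}
    (hfin : volume Ω < ⊤) (T : ℝ) : LocallyIntegrable (truncatedTube N Ω T) := by
  have h : LocallyIntegrable (fun t => (tubeVol N Ω t : ℂ)) := fun x =>
    ((tubeVol_antitone hfin).locallyIntegrable x).imp fun _ hs => ⟨hs.1, hs.2.ofReal⟩
  exact h.indicator measurableSet_Ioi

theorem truncatedTube_isBigO_atTop {N : ℕ} {Ω : Set (EuclideanSpace ℝ (Fin N))}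
    (hfin : volume Ω < ⊤) (T : ℝ) {r : ℝ} (hr : upperMinkDim N Ω < r) :
    truncatedTube N Ω T =O[atTop] fun t : ℝ => t ^ (-(-((N : ℝ) + r))) := by
  refine Asymptotics.IsBigO.of_bound 1 ?_
  filter_upwards [eventually_tubeVol_le hfin hr] with t ht
  calc ‖truncatedTube N Ω T t‖ ≤ ‖(tubeVol N Ω t : ℂ)‖ := norm_indicator_le_norm_self _ _
    _ = tubeVol N Ω t := by rw [Complex.norm_real, Real.norm_of_nonneg (tubeVol_nonneg N Ω t)]
    _ ≤ 1 * ‖t ^ (-(-((N : ℝ) + r)))‖ := by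
      rw [neg_neg, one_mul]
      exact ht.trans (le_abs_self _)

theorem truncatedTube_isBigO_zero (N : ℕ) (Ω : Set (EuclideanSpace ℝ (Fin N))) {T : ℝ}
    (hT : 0 < T) (b : ℝ) : truncatedTube N Ω T =O[𝓝[>] 0] fun t : ℝ => t ^ (-b) := by
  refine Asymptotics.IsBigO.of_bound 1 ?_
  filter_upwards [nhdsWithin_le_nhds (Iio_mem_nhds hT)] with t ht
  have hzero : truncatedTube N Ω T t = 0 :=
    indicator_of_notMem (fun h : T < t => lt_asymm h ht) _
  rw [hzero, norm_zero]
  positivity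

theorem cpow_smul_truncatedTube (N : ℕ) (Ω : Set (EuclideanSpace ℝ (Fin N))) (T : ℝ) (s : ℂ) :
    (fun t : ℝ => (t : ℂ) ^ (-s - (N : ℂ) - 1) • truncatedTube N Ω T t) =
      (Ioi T).indicator fun t : ℝ =>
        (t : ℂ) ^ (-s - (N : ℂ) - 1) * ((tubeVol N Ω t : ℝ) : ℂ) := by
  funext t
  by_cases h : t ∈ Ioi T <;> simp [truncatedTube, h]

theorem mellin_truncatedTube (N : ℕ) (Ω : Set (EuclideanSpace ℝ (Fin N))) {T : ℝ} (hT : 0 < T)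
    (s : ℂ) : mellin (truncatedTube N Ω T) (-s - N) = tubeZeta N Ω T s := by
  rw [mellin, cpow_smul_truncatedTube, setIntegral_indicator measurableSet_Ioi,
    inter_eq_self_of_subset_right (Ioi_subset_Ioi hT.le), tubeZeta]

theorem integrableOn_tubeZeta {N : ℕ} {Ω : Set (EuclideanSpace ℝ (Fin N))}
    (hfin : volume Ω < ⊤) {T : ℝ} (hT : 0 < T) {s : ℂ} (hs : upperMinkDim N Ω < s.re) :
    IntegrableOn (fun t : ℝ => (t : ℂ) ^ (-s - (N : ℂ) - 1) * ((tubeVol N Ω t : ℝ) : ℂ))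
      (Ioi T) volume := by
  obtain ⟨r, hr, hrs⟩ := exists_between hs
  have h : MellinConvergent (truncatedTube N Ω T) (-s - N) :=
    mellinConvergent_of_isBigO_rpow
      ((truncatedTube_locallyIntegrable hfin T).locallyIntegrableOn _)
      (truncatedTube_isBigO_atTop hfin T hr) (by simp; linarith)
      (truncatedTube_isBigO_zero N Ω hT _) (sub_one_lt _)
  rw [MellinConvergent, cpow_smul_truncatedTube] at h
  exact (h.mono_set (Ioi_subset_Ioi hT.le)).congr_fun
    (fun t ht => indicator_of_mem ht _) measurableSet_Ioi

theorem differentiableAt_tubeZeta {N : ℕ} {Ω : Set (EuclideanSpace ℝ (Fin N))}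
    (hfin : volume Ω < ⊤) {T : ℝ} (hT : 0 < T) {s : ℂ} (hs : upperMinkDim N Ω < s.re) :
    DifferentiableAt ℂ (tubeZeta N Ω T) s := by
  obtain ⟨r, hr, hrs⟩ := exists_between hs
  have h : DifferentiableAt ℂ (mellin (truncatedTube N Ω T)) (-s - N) :=
    mellin_differentiableAt_of_isBigO_rpow
      ((truncatedTube_locallyIntegrable hfin T).locallyIntegrableOn _)
      (truncatedTube_isBigO_atTop hfin T hr) (by simp; linarith)
      (truncatedTube_isBigO_zero N Ω hT _) (sub_one_lt _)
  rw [show tubeZeta N Ω T = mellin (truncatedTube N Ω T) ∘ fun z : ℂ => -z - N from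
    funext fun z => (mellin_truncatedTube N Ω hT z).symm]
  exact h.comp s (by fun_prop)

theorem norm_tubeZeta_le {N : ℕ} {Ω : Set (EuclideanSpace ℝ (Fin N))} {T C r : ℝ} (hT : 0 < T)
    (hC : ∀ t : ℝ, T < t → tubeVol N Ω t ≤ C * t ^ ((N : ℝ) + r)) {s : ℂ} (hs : r < s.re) :
    ‖tubeZeta N Ω T s‖ ≤ C * T ^ (r - s.re) / (s.re - r) := by
  have hexp : r - s.re - 1 < -1 := by linarith
  have hbound : ∀ t ∈ Ioi T,
      ‖(t : ℂ) ^ (-s - (N : ℂ) - 1) * ((tubeVol N Ω t : ℝ) : ℂ)‖ ≤ C * t ^ (r - s.re - 1) := by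
    intro t ht
    have ht0 : 0 < t := hT.trans ht
    rw [norm_mul, norm_cpow_eq_rpow_re_of_pos ht0, Complex.norm_real,
      Real.norm_of_nonneg (tubeVol_nonneg N Ω t)]
    calc t ^ (-s - (N : ℂ) - 1).re * tubeVol N Ω t
        ≤ t ^ (-s - (N : ℂ) - 1).re * (C * t ^ ((N : ℝ) + r)) := by
          gcongr
          exact hC t ht
      _ = C * t ^ (r - s.re - 1) := by
          rw [mul_left_comm, ← Real.rpow_add ht0]
          congr 2
          simp
          ring
  calc ‖tubeZeta N Ω T s‖ ≤ ∫ t in Ioi T, C * t ^ (r - s.re - 1) :=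
        norm_integral_le_of_norm_le ((integrableOn_Ioi_rpow_of_lt hexp hT).const_mul C)
          (ae_restrict_of_forall_mem measurableSet_Ioi hbound)
    _ = C * T ^ (r - s.re) / (s.re - r) := by
        rw [integral_const_mul, integral_Ioi_rpow_of_lt hexp hT, sub_add_cancel, neg_div,
          ← div_neg, neg_sub, mul_div_assoc]

/-- the tube zeta function at infinity converges absolutely and is holomorphic
on `{Re s > dim̄_B(∞,Ω)}`, with the explicit bound
`‖ζ̃(s;T)‖ ≤ C_T · T^(D̄+ε−Re s)/(Re s − D̄ − ε)` for `Re s > D̄ + ε`. -/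
theorem tube_zeta_holomorphic_and_bound
    (N : ℕ) (Ω : Set (EuclideanSpace ℝ (Fin N)))
    (hmeas : MeasurableSet Ω) (hfin : volume Ω < ⊤)
    (T : ℝ) (hT : 0 < T) :
    (∀ s : ℂ, upperMinkDim N Ω < s.re →
      IntegrableOn (fun t : ℝ => (t : ℂ) ^ (-s - (N : ℂ) - 1) * ((tubeVol N Ω t : ℝ) : ℂ))
        (Set.Ioi T) volume) ∧
    DifferentiableOn ℂ (tubeZeta N Ω T) {s : ℂ | upperMinkDim N Ω < s.re} ∧
    ∀ ε : ℝ, 0 < ε → ∃ C : ℝ, 0 < C ∧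
      (∀ t : ℝ, T < t → tubeVol N Ω t ≤ C * t ^ ((N : ℝ) + upperMinkDim N Ω + ε)) ∧
      (∀ s : ℂ, upperMinkDim N Ω + ε < s.re →
        ‖tubeZeta N Ω T s‖
          ≤ C * T ^ (upperMinkDim N Ω + ε - s.re) / (s.re - upperMinkDim N Ω - ε)) := by
  refine ⟨fun s hs => integrableOn_tubeZeta hfin hT hs,
    fun s hs => (differentiableAt_tubeZeta hfin hT hs).differentiableWithinAt, fun ε hε => ?_⟩
  obtain ⟨C, hC0, hC⟩ := exists_tubeVol_le hfin hT (lt_add_of_pos_right (upperMinkDim N Ω) hε)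
  refine ⟨C, hC0, fun t ht => ?_, fun s hs => ?_⟩
  · rw [add_assoc]
    exact hC t ht
  · rw [sub_sub]
    exact norm_tubeZeta_le hT hC hs
end
end

section
/- Let Ω ⊆ ℝ^N be Lebesgue measurable with |Ω| < ∞ and suppose there exist α > 0, 𝓜 ∈ (0,+∞) and D < −N such that |_tΩ| = t^{N+D}(𝓜 + O(t^{-α})) as t → +∞. Then dim_B(∞,Ω) exists and equals D, and Ω is Minkowski measurable at infinity with Minkowski content 𝓜^D(∞,Ω) = 𝓜. Moreover the tube zeta function ζ̃_{∞,Ω} has abscissa of (absolute) convergence equal to D and possesses a unique meromorphic continuation to (at least) the open half-plane {Re s > D − α}; its only pole in this half-plane is s = D, this pole is simple, and lim_{s→D} (s−D)ζ̃_{∞,Ω}(s) = 𝓜. -/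
open MeasureTheory Filter Set Complex Topology
open scoped ENNReal Real

noncomputable section

section TubeFunction

variable {N : ℕ} {Ω : Set (EuclideanSpace ℝ (Fin N))}

lemma volume_tailSet_ne_top (hfin : volume Ω < ⊤) (t : ℝ) : volume (tailSet N Ω t) ≠ ⊤ :=
  ((measure_mono fun _ hx => hx.1).trans_lt hfin).ne

lemma antitone_tubeVol (hfin : volume Ω < ⊤) : Antitone (tubeVol N Ω) := fun _ _ h =>
  ENNReal.toReal_mono (volume_tailSet_ne_top hfin _)
    (measure_mono fun _ hx => ⟨hx.1, h.trans hx.2⟩)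

lemma tendsto_tubeVol_div_rpow {α M D C t₀ : ℝ} (hα : 0 < α)
    (h : ∀ t : ℝ, t₀ ≤ t →
      |tubeVol N Ω t - t ^ ((N : ℝ) + D) * M| ≤ C * t ^ ((N : ℝ) + D - α)) :
    Tendsto (fun t : ℝ => tubeVol N Ω t / t ^ ((N : ℝ) + D)) atTop (𝓝 M) := by
  rw [tendsto_iff_norm_sub_tendsto_zero]
  have hlim : Tendsto (fun t : ℝ => C * t ^ (-α)) atTop (𝓝 0) := by
    simpa using (tendsto_rpow_neg_atTop hα).const_mul C
  refine squeeze_zero' (Eventually.of_forall fun _ => norm_nonneg _) ?_ hlim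
  filter_upwards [eventually_ge_atTop t₀, eventually_gt_atTop 0] with t ht ht0
  have hp : 0 < t ^ ((N : ℝ) + D) := Real.rpow_pos_of_pos ht0 _
  have he : tubeVol N Ω t / t ^ ((N : ℝ) + D) - M
      = (tubeVol N Ω t - t ^ ((N : ℝ) + D) * M) / t ^ ((N : ℝ) + D) := by
    field_simp
  rw [he, norm_div, Real.norm_eq_abs, Real.norm_of_nonneg hp.le, div_le_iff₀ hp, mul_assoc,
    ← Real.rpow_add ht0, neg_add_eq_sub]
  exact h t ht

lemma minkContent_quotient_eventuallyEq (hfin : volume Ω < ⊤) (D r : ℝ) :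
    (fun t : ℝ => volume (tailSet N Ω t) / ENNReal.ofReal (t ^ ((N : ℝ) + r))) =ᶠ[atTop]
      fun t : ℝ => ENNReal.ofReal (tubeVol N Ω t / t ^ ((N : ℝ) + D) * t ^ (D - r)) := by
  filter_upwards [eventually_gt_atTop 0] with t ht
  have hp : 0 < t ^ ((N : ℝ) + r) := Real.rpow_pos_of_pos ht _
  rw [show tubeVol N Ω t / t ^ ((N : ℝ) + D) * t ^ (D - r) = tubeVol N Ω t / t ^ ((N : ℝ) + r) by
      rw [show (N : ℝ) + D = (N + r) + (D - r) by ring, Real.rpow_add ht]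
      have := Real.rpow_pos_of_pos ht (D - r)
      field_simp,
    ENNReal.ofReal_div_of_pos hp, tubeVol, ENNReal.ofReal_toReal (volume_tailSet_ne_top hfin t)]

variable {M D : ℝ}

lemma minkContent_self (hfin : volume Ω < ⊤)
    (h : Tendsto (fun t : ℝ => tubeVol N Ω t / t ^ ((N : ℝ) + D)) atTop (𝓝 M)) :
    lowerMinkContent N Ω D = ENNReal.ofReal M ∧ upperMinkContent N Ω D = ENNReal.ofReal M := by
  have := (ENNReal.tendsto_ofReal h).congr'
    ((minkContent_quotient_eventuallyEq hfin D D).trans (by simp)).symm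
  exact ⟨this.liminf_eq, this.limsup_eq⟩

lemma minkContent_of_gt (hfin : volume Ω < ⊤)
    (h : Tendsto (fun t : ℝ => tubeVol N Ω t / t ^ ((N : ℝ) + D)) atTop (𝓝 M))
    {r : ℝ} (hr : D < r) :
    lowerMinkContent N Ω r = 0 ∧ upperMinkContent N Ω r = 0 := by
  have hlim := h.mul (tendsto_rpow_neg_atTop (sub_pos.2 hr))
  simp only [neg_sub, mul_zero] at hlim
  have := (ENNReal.tendsto_ofReal hlim).congr' (minkContent_quotient_eventuallyEq hfin D r).symm
  rw [ENNReal.ofReal_zero] at this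
  exact ⟨this.liminf_eq, this.limsup_eq⟩

lemma minkContent_of_lt (hfin : volume Ω < ⊤) (hM : 0 < M)
    (h : Tendsto (fun t : ℝ => tubeVol N Ω t / t ^ ((N : ℝ) + D)) atTop (𝓝 M))
    {r : ℝ} (hr : r < D) :
    lowerMinkContent N Ω r = ⊤ ∧ upperMinkContent N Ω r = ⊤ := by
  have hlim := h.pos_mul_atTop hM (tendsto_rpow_atTop (sub_pos.2 hr))
  have := (ENNReal.tendsto_ofReal_atTop.comp hlim).congr'
    (minkContent_quotient_eventuallyEq hfin D r).symm
  exact ⟨this.liminf_eq, this.limsup_eq⟩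

lemma minkDim_eq (hfin : volume Ω < ⊤) (hM : 0 < M)
    (h : Tendsto (fun t : ℝ => tubeVol N Ω t / t ^ ((N : ℝ) + D)) atTop (𝓝 M)) :
    lowerMinkDim N Ω = D ∧ upperMinkDim N Ω = D := by
  have key (r : ℝ) : (lowerMinkContent N Ω r = 0 ↔ D < r) ∧
      (upperMinkContent N Ω r = 0 ↔ D < r) := by
    rcases lt_trichotomy D r with hr | rfl | hr
    · simp [minkContent_of_gt hfin h hr, hr]
    · simp [minkContent_self hfin h, hM]
    · simp [minkContent_of_lt hfin hM h hr, hr.le]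
  constructor
  · rw [lowerMinkDim, show {r : ℝ | lowerMinkContent N Ω r = 0} = Ioi D from
      Set.ext fun r => (key r).1, csInf_Ioi]
  · rw [upperMinkDim, show {r : ℝ | upperMinkContent N Ω r = 0} = Ioi D from
      Set.ext fun r => (key r).2, csInf_Ioi]

/-- The remainder `|_tΩ| - M t^{N+D}`, cut off to `t > T`. -/
def tubeRemainder (N : ℕ) (Ω : Set (EuclideanSpace ℝ (Fin N))) (T M D : ℝ) : ℝ → ℂ :=
  (Ioi T).indicator fun t => ((tubeVol N Ω t - t ^ ((N : ℝ) + D) * M : ℝ) : ℂ)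

variable {T : ℝ}

lemma locallyIntegrableOn_tubeRemainder (hfin : volume Ω < ⊤) :
    LocallyIntegrableOn (tubeRemainder N Ω T M D) (Ioi 0) := by
  have h1 : LocallyIntegrableOn (tubeVol N Ω) (Ioi 0) :=
    (antitone_tubeVol hfin).locallyIntegrable.locallyIntegrableOn _
  have h2 : LocallyIntegrableOn (fun t : ℝ => t ^ ((N : ℝ) + D) * M) (Ioi 0) := by
    refine ContinuousOn.locallyIntegrableOn (fun t ht => ?_) measurableSet_Ioi
    exact ((Real.continuousAt_rpow_const _ _ (Or.inl (ne_of_gt ht))).mul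
      continuousAt_const).continuousWithinAt
  intro x hx
  obtain ⟨u, hu, hi⟩ := h1.sub h2 x hx
  exact ⟨u, hu, hi.ofReal.indicator measurableSet_Ioi⟩

lemma tubeRemainder_isBigO_zero (hT : 0 < T) (b : ℝ) :
    tubeRemainder N Ω T M D =O[𝓝[>] 0] (fun t : ℝ => t ^ (-b)) := by
  refine Asymptotics.IsBigO.of_bound 0 ?_
  filter_upwards [mem_nhdsWithin_of_mem_nhds (Iio_mem_nhds hT)] with t ht
  rw [tubeRemainder, indicator_of_notMem (by simpa using ht.le)]
  simp

lemma tubeRemainder_isBigO_atTop {α C t₀ : ℝ}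
    (h : ∀ t : ℝ, t₀ ≤ t →
      |tubeVol N Ω t - t ^ ((N : ℝ) + D) * M| ≤ C * t ^ ((N : ℝ) + D - α)) :
    tubeRemainder N Ω T M D =O[atTop] (fun t : ℝ => t ^ (-(α - N - D))) := by
  refine Asymptotics.IsBigO.of_bound C ?_
  filter_upwards [eventually_ge_atTop t₀, eventually_gt_atTop 0, eventually_gt_atTop T]
    with t ht ht0 htT
  rw [tubeRemainder, indicator_of_mem (mem_Ioi.2 htT), Complex.norm_real, Real.norm_eq_abs,
    Real.norm_of_nonneg (Real.rpow_nonneg ht0.le _)]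
  convert h t ht using 3
  ring

lemma integrableOn_cpow_mul_tubeRemainder {s : ℂ} (hT : 0 < T)
    (h : MellinConvergent (tubeRemainder N Ω T M D) (-s - N)) :
    IntegrableOn (fun t : ℝ => (t : ℂ) ^ (-s - (N : ℂ) - 1) * tubeRemainder N Ω T M D t)
      (Ioi T) :=
  h.mono_set (Ioi_subset_Ioi hT.le)

lemma mellin_tubeRemainder (hT : 0 < T) (s : ℂ) :
    mellin (tubeRemainder N Ω T M D) (-s - N) =
      ∫ t in Ioi T, (t : ℂ) ^ (-s - (N : ℂ) - 1) * tubeRemainder N Ω T M D t := by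
  refine setIntegral_eq_of_subset_of_forall_sdiff_eq_zero measurableSet_Ioi
    (Ioi_subset_Ioi hT.le) fun t ht => ?_
  simp [tubeRemainder, indicator_of_notMem ht.2]

lemma cpow_mul_tubeVol_eq (hT : 0 < T) (s : ℂ) {t : ℝ} (ht : t ∈ Ioi T) :
    (t : ℂ) ^ (-s - (N : ℂ) - 1) * ((tubeVol N Ω t : ℝ) : ℂ) =
      (t : ℂ) ^ (-s - (N : ℂ) - 1) * tubeRemainder N Ω T M D t + M * (t : ℂ) ^ (D - s - 1) := by
  have ht0 : 0 < t := hT.trans ht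
  rw [tubeRemainder, indicator_of_mem ht, show (D : ℂ) - s - 1 = (-s - N - 1) + ((N + D : ℝ) : ℂ) by
    push_cast; ring, Complex.cpow_add _ _ (by exact_mod_cast ht0.ne'),
    ← Complex.ofReal_cpow ht0.le]
  push_cast
  ring

lemma integrableOn_cpow_mul_tubeVol_iff {s : ℂ} (hT : 0 < T) (hM : 0 < M)
    (h : MellinConvergent (tubeRemainder N Ω T M D) (-s - N)) :
    IntegrableOn (fun t : ℝ => (t : ℂ) ^ (-s - (N : ℂ) - 1) * ((tubeVol N Ω t : ℝ) : ℂ))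
      (Ioi T) ↔ D < s.re := by
  rw [integrableOn_congr_fun (fun t ht => cpow_mul_tubeVol_eq hT s ht) measurableSet_Ioi]
  have hR := integrableOn_cpow_mul_tubeRemainder hT h
  have hMne : (M : ℂ) ≠ 0 := by exact_mod_cast hM.ne'
  have hre : ((D : ℂ) - s - 1).re < -1 ↔ D < s.re := by
    simp only [sub_re, ofReal_re, one_re]
    constructor <;> intro <;> linarith
  rw [← hre, ← integrableOn_Ioi_cpow_iff hT]
  refine ⟨fun hi => ?_, fun hi => hR.add (hi.const_mul _)⟩
  have := (hi.sub hR).const_mul (M : ℂ)⁻¹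
  refine this.congr (Eventually.of_forall fun t => ?_)
  simp [hMne]

lemma tubeZeta_eq {s : ℂ} (hT : 0 < T) (hs : D < s.re)
    (h : MellinConvergent (tubeRemainder N Ω T M D) (-s - N)) :
    tubeZeta N Ω T s =
      mellin (tubeRemainder N Ω T M D) (-s - N) + M * (T : ℂ) ^ (D - s) / (s - D) := by
  have hre : ((D : ℂ) - s - 1).re < -1 := by
    simp only [sub_re, ofReal_re, one_re]
    linarith
  have hne : s - D ≠ 0 := fun h0 => by simpa using hs.trans_eq (congrArg re (sub_eq_zero.1 h0))
  have hne' : (D : ℂ) - s ≠ 0 := fun h0 => hne (by rw [← neg_sub, h0, neg_zero])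
  rw [tubeZeta, setIntegral_congr_fun measurableSet_Ioi
    (fun t ht => cpow_mul_tubeVol_eq (M := M) (D := D) hT s ht), integral_add
    (integrableOn_cpow_mul_tubeRemainder hT h)
    ((integrableOn_Ioi_cpow_of_lt hre hT).const_mul _), mellin_tubeRemainder hT,
    integral_const_mul, integral_Ioi_cpow_of_lt hre hT, sub_add_cancel, ← neg_sub s (D : ℂ)]
  field_simp

end TubeFunction

lemma isPreconnected_halfPlane_diff_singleton {a c : ℝ} (hac : a < c) :
    IsPreconnected ({s : ℂ | a < s.re} \ {(c : ℂ)}) := by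
  have hA : IsPreconnected {s : ℂ | c < s.re} := (convex_halfSpace_re_gt c).isPreconnected
  have hL : IsPreconnected ({s : ℂ | a < s.re} ∩ {s : ℂ | s.re < c}) :=
    ((convex_halfSpace_re_gt a).inter (convex_halfSpace_re_lt c)).isPreconnected
  have hU : IsPreconnected ({s : ℂ | a < s.re} ∩ {s : ℂ | 0 < s.im}) :=
    ((convex_halfSpace_re_gt a).inter (convex_halfSpace_im_gt 0)).isPreconnected
  have hD : IsPreconnected ({s : ℂ | a < s.re} ∩ {s : ℂ | s.im < 0}) :=
    ((convex_halfSpace_re_gt a).inter (convex_halfSpace_im_lt 0)).isPreconnected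
  have h := ((hA.union (⟨c + 1, 1⟩ : ℂ) (by simp) (by exact ⟨by simp; linarith, by simp⟩) hU).union
    (⟨c + 1, -1⟩ : ℂ) (by simp) (by exact ⟨by simp; linarith, by simp⟩) hD).union
    (⟨(a + c) / 2, 1⟩ : ℂ) (by exact Or.inl (Or.inr ⟨by simp; linarith, by simp⟩))
    (by exact ⟨by simp; linarith, by simp; linarith⟩) hL
  convert h using 1
  ext s
  simp only [Set.mem_sdiff, mem_ofPred_eq, mem_singleton_iff, Complex.ext_iff, ofReal_re, ofReal_im,
    mem_union, mem_inter_iff]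
  clear hA hL hU hD h
  grind

/-- meromorphic extension of the tube zeta function in the Minkowski
measurable case `|_tΩ| = t^{N+D}(𝓜 + O(t^{-α}))` as `t → +∞`. -/
theorem tube_zeta_meromorphic_extension_measurable_case
    (N : ℕ) (Ω : Set (EuclideanSpace ℝ (Fin N)))
    (hmeas : MeasurableSet Ω) (hfin : volume Ω < ⊤)
    (T : ℝ) (hT : 0 < T)
    (α : ℝ) (hα : 0 < α) (M : ℝ) (hM : 0 < M) (D : ℝ) (hD : D < -(N : ℝ))
    (hasym : ∃ C > (0 : ℝ), ∃ t₀ > (0 : ℝ), ∀ t : ℝ, t₀ ≤ t →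
      |tubeVol N Ω t - t ^ ((N : ℝ) + D) * M| ≤ C * t ^ ((N : ℝ) + D - α)) :
    lowerMinkDim N Ω = D ∧ upperMinkDim N Ω = D ∧
    Tendsto (fun t : ℝ => tubeVol N Ω t / t ^ ((N : ℝ) + D)) atTop (𝓝 M) ∧
    lowerMinkContent N Ω D = ENNReal.ofReal M ∧
    upperMinkContent N Ω D = ENNReal.ofReal M ∧
    tubeAbscissa N Ω T = D ∧
    ∃ g : ℂ → ℂ,
      DifferentiableOn ℂ g ({s : ℂ | D - α < s.re} \ {(D : ℂ)}) ∧
      (∀ s : ℂ, D < s.re → g s = tubeZeta N Ω T s) ∧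
      Tendsto (fun s : ℂ => (s - (D : ℂ)) * g s) (𝓝[≠] (D : ℂ)) (𝓝 (M : ℂ)) ∧
      (∀ g' : ℂ → ℂ,
        DifferentiableOn ℂ g' ({s : ℂ | D - α < s.re} \ {(D : ℂ)}) →
        (∀ s : ℂ, D < s.re → g' s = tubeZeta N Ω T s) →
        ∀ s ∈ {s : ℂ | D - α < s.re} \ {(D : ℂ)}, g' s = g s) := by
  obtain ⟨C, -, t₀, -, hC⟩ := hasym
  have hlim := tendsto_tubeVol_div_rpow hα hC
  have hdim := minkDim_eq hfin hM hlim
  have hcont := minkContent_self hfin hlim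
  have hloc : LocallyIntegrableOn (tubeRemainder N Ω T M D) (Ioi 0) :=
    locallyIntegrableOn_tubeRemainder hfin
  have hre {s : ℂ} (hs : D - α < s.re) : (-s - (N : ℂ)).re < α - N - D := by
    simp only [sub_re, neg_re, natCast_re]
    linarith
  have hconv {s : ℂ} (hs : D - α < s.re) :
      MellinConvergent (tubeRemainder N Ω T M D) (-s - N) :=
    mellinConvergent_of_isBigO_rpow hloc (tubeRemainder_isBigO_atTop hC) (hre hs)
      (tubeRemainder_isBigO_zero hT _) (sub_one_lt _)
  have hdiff {s : ℂ} (hs : D - α < s.re) :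
      DifferentiableAt ℂ (fun s => mellin (tubeRemainder N Ω T M D) (-s - N)) s :=
    DifferentiableAt.comp (g := mellin (tubeRemainder N Ω T M D)) s
      (mellin_differentiableAt_of_isBigO_rpow hloc (tubeRemainder_isBigO_atTop hC) (hre hs)
        (tubeRemainder_isBigO_zero hT _) (sub_one_lt _))
      (differentiableAt_id.neg.sub_const _)
  have hTc : (T : ℂ) ≠ 0 := by exact_mod_cast hT.ne'
  have hpow : Differentiable ℂ fun s : ℂ => M * (T : ℂ) ^ (D - s) := fun s =>
    ((differentiableAt_id.const_sub _).const_cpow (Or.inl hTc)).const_mul _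
  set g : ℂ → ℂ := fun s =>
    mellin (tubeRemainder N Ω T M D) (-s - N) + M * (T : ℂ) ^ (D - s) / (s - D) with hg
  have hgd : DifferentiableOn ℂ g ({s : ℂ | D - α < s.re} \ {(D : ℂ)}) := fun s hs =>
    ((hdiff hs.1).add ((hpow s).div (differentiableAt_id.sub_const _)
      (sub_ne_zero.2 hs.2))).differentiableWithinAt
  have hgz (s : ℂ) (hs : D < s.re) : g s = tubeZeta N Ω T s :=
    (tubeZeta_eq hT hs (hconv (by linarith))).symm
  refine ⟨hdim.1, hdim.2, hlim, hcont.1, hcont.2, ?_, g, hgd, hgz, ?_, ?_⟩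
  · rw [tubeAbscissa, ← csInf_Ici (a := D)]
    congr 1
    ext σ
    refine ⟨fun h => ?_, fun h s hs => ?_⟩
    · by_contra hσ
      obtain ⟨x, hx, hxD⟩ := exists_between (max_lt (not_le.1 hσ) (sub_lt_self D hα))
      have hx' := max_lt_iff.1 hx
      have := (integrableOn_cpow_mul_tubeVol_iff hT hM (hconv (s := x) hx'.2)).1 (h x hx'.1)
      exact hxD.not_gt this
    · have hDs : D < s.re := lt_of_le_of_lt h hs
      exact (integrableOn_cpow_mul_tubeVol_iff hT hM (hconv (by linarith))).2 hDs
  · have hcts : ContinuousAt (fun s : ℂ => (s - D) * mellin (tubeRemainder N Ω T M D) (-s - N)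
        + M * (T : ℂ) ^ (D - s)) D :=
      ((continuousAt_id.sub continuousAt_const).mul
        (hdiff (by simpa using hα)).continuousAt).add hpow.continuous.continuousAt
    have ht := hcts.tendsto.mono_left (nhdsWithin_le_nhds (s := {(D : ℂ)}ᶜ))
    simp only [sub_self, zero_mul, cpow_zero, mul_one, zero_add] at ht
    refine ht.congr' ?_
    filter_upwards [self_mem_nhdsWithin] with s hs
    rw [hg, mul_add, mul_div_cancel₀ _ (sub_ne_zero.2 hs)]
  · intro g' hg'd hg'z
    have hopen : IsOpen ({s : ℂ | D - α < s.re} \ {(D : ℂ)}) :=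
      (isOpen_lt continuous_const continuous_re).sdiff isClosed_singleton
    have hmem : ((D + 1 : ℝ) : ℂ) ∈ {s : ℂ | D - α < s.re} \ {(D : ℂ)} := by
      refine ⟨?_, ?_⟩
      · simp only [mem_ofPred_eq, ofReal_re]
        linarith
      · simp
    refine (hg'd.analyticOnNhd hopen).eqOn_of_preconnected_of_eventuallyEq
      (hgd.analyticOnNhd hopen) (isPreconnected_halfPlane_diff_singleton (by linarith)) hmem ?_
    filter_upwards [(isOpen_lt continuous_const continuous_re).mem_nhds
      (show D < ((D + 1 : ℝ) : ℂ).re by simp)] with s hs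
    rw [hg'z s hs, hgz s hs]
end
end

section
/- Let Ω ⊆ ℝ^N be Lebesgue measurable with |Ω| < ∞ and suppose there exist D < −N, α > 0, and a nonconstant periodic function G : ℝ → (0,+∞) with period T > 0 such that |_tΩ| = t^{N+D}(G(log t) + O(t^{-α})) as t → +∞. Then G is continuous, dim_B(∞,Ω) exists and equals D, and Ω is Minkowski nondegenerate but not Minkowski measurable at infinity, with 𝓜̲^D(∞,Ω) = min G and 𝓜̄^D(∞,Ω) = max G; in particular the range of G restricted to [0,T] equals the interval [𝓜̲^D(∞,Ω), 𝓜̄^D(∞,Ω)]. -/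
open MeasureTheory Filter Set Complex Topology
open scoped ENNReal Real

noncomputable section

lemma tubeVol_continuousAt {N : ℕ} {Ω : Set (EuclideanSpace ℝ (Fin N))}
    (hfin : volume Ω < ⊤) {t : ℝ} (ht : 0 < t) :
    ContinuousAt (tubeVol N Ω) t := by
  have hnorm (s : ℝ) : MeasurableSet {x : EuclideanSpace ℝ (Fin N) | s ≤ ‖x‖} :=
    measurableSet_le measurable_const measurable_norm
  have hrepr : tubeVol N Ω = fun s =>
      ∫ x in Ω, {x : EuclideanSpace ℝ (Fin N) | s ≤ ‖x‖}.indicator (fun _ => (1 : ℝ)) x := by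
    funext s
    rw [integral_indicator (hnorm s), setIntegral_const, smul_eq_mul, mul_one,
      Measure.real, Measure.restrict_apply (hnorm s), inter_comm]
    rfl
  rw [hrepr]
  refine continuousAt_of_dominated (bound := fun _ => (1 : ℝ)) ?_ ?_ ?_ ?_
  · exact .of_forall fun s => (measurable_const.indicator (hnorm s)).aestronglyMeasurable
  · refine .of_forall fun s => .of_forall fun x => ?_
    by_cases h : s ≤ ‖x‖ <;> simp [indicator, h]
  · exact integrableOn_const hfin.ne
  · have hsphere : ∀ᵐ x : EuclideanSpace ℝ (Fin N), ‖x‖ ≠ t := by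
      have h := Measure.addHaar_sphere_of_ne_zero
        (volume : Measure (EuclideanSpace ℝ (Fin N))) 0 ht.ne'
      filter_upwards [measure_eq_zero_iff_ae_notMem.1 h] with x hx
      simpa using hx
    filter_upwards [ae_restrict_of_ae hsphere] with x hx
    rcases hx.lt_or_gt with hlt | hgt
    · refine (continuousAt_const (y := (0 : ℝ))).congr ?_
      filter_upwards [lt_mem_nhds hlt] with s hs
      simp [indicator, hs]
    · refine (continuousAt_const (y := (1 : ℝ))).congr ?_
      filter_upwards [gt_mem_nhds hgt] with s hs
      simp [indicator, hs.le]

lemma volume_tailSet_div_eq {N : ℕ} {Ω : Set (EuclideanSpace ℝ (Fin N))}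
    (hfin : volume Ω < ⊤) (r : ℝ) {t : ℝ} (ht : 0 < t) :
    volume (tailSet N Ω t) / ENNReal.ofReal (t ^ ((N : ℝ) + r)) =
      ENNReal.ofReal (tubeVol N Ω t / t ^ ((N : ℝ) + r)) := by
  have hne : volume (tailSet N Ω t) ≠ ⊤ :=
    ((measure_mono fun _ hx => hx.1).trans_lt hfin).ne
  rw [ENNReal.ofReal_div_of_pos (Real.rpow_pos_of_pos ht _), tubeVol, ENNReal.ofReal_toReal hne]

lemma abs_div_rpow_sub_le {v g C t d α : ℝ} (ht : 0 < t)
    (h : |v - t ^ d * g| ≤ C * t ^ (d - α)) : |v / t ^ d - g| ≤ C * t ^ (-α) := by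
  have hd : 0 < t ^ d := Real.rpow_pos_of_pos ht d
  have heq : v / t ^ d - g = (v - t ^ d * g) / t ^ d := by field_simp
  rw [heq, abs_div, abs_of_pos hd, div_le_iff₀ hd, mul_assoc, ← Real.rpow_add ht]
  rwa [show -α + d = d - α by ring]

lemma tendsto_exp_add_mul_atTop {T : ℝ} (hT : 0 < T) (τ : ℝ) :
    Tendsto (fun n : ℕ => Real.exp (τ + n * T)) atTop atTop :=
  Real.tendsto_exp_atTop.comp <| tendsto_atTop_add_const_left _ _ <|
    tendsto_natCast_atTop_atTop.atTop_mul_const hT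

/-- A `T`-periodic function `G` with `u t - G (log t) → 0` is recovered as a limit of `u` along
`t = exp (τ + n T)`. -/
lemma tendsto_periodic_of_sub_log {u G : ℝ → ℝ} {T : ℝ} (hT : 0 < T)
    (hper : Function.Periodic G T)
    (hlim : Tendsto (fun t => u t - G (Real.log t)) atTop (𝓝 0)) (τ : ℝ) :
    Tendsto (fun n : ℕ => u (Real.exp (τ + n * T))) atTop (𝓝 (G τ)) := by
  have h := (hlim.comp (tendsto_exp_add_mul_atTop hT τ)).add_const (G τ)
  refine (h.congr fun n => ?_).trans (by simp)
  simp [Function.comp, hper.nat_mul n τ]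

lemma continuous_of_periodic_sub_log {u G : ℝ → ℝ} {T : ℝ} (hT : 0 < T)
    (hu : ∀ t, 0 < t → ContinuousAt u t) (hper : Function.Periodic G T)
    (hlim : Tendsto (fun t => u t - G (Real.log t)) atTop (𝓝 0)) : Continuous G := by
  rw [continuous_iff_continuousAt]
  intro τ
  rw [Metric.continuousAt_iff']
  intro ε hε
  obtain ⟨A, hA⟩ := eventually_atTop.1 (Metric.tendsto_nhds.1 hlim (ε / 3) (by positivity))
  obtain ⟨n, hn⟩ := ((tendsto_exp_add_mul_atTop hT (τ - 1)).eventually_ge_atTop A).exists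
  have hclose : ∀ σ, τ - 1 ≤ σ → |u (Real.exp (σ + n * T)) - G σ| < ε / 3 := by
    intro σ hσ
    have h := hA (Real.exp (σ + n * T)) (hn.trans (Real.exp_le_exp.2 (by linarith)))
    simpa [hper.nat_mul n σ, Real.dist_eq] using h
  have hcont : ContinuousAt (fun σ => u (Real.exp (σ + n * T))) τ :=
    ContinuousAt.comp (f := fun σ => Real.exp (σ + n * T)) (hu _ (Real.exp_pos _)) (by fun_prop)
  filter_upwards [Metric.continuousAt_iff'.1 hcont (ε / 3) (by positivity),
    lt_mem_nhds (show τ - 1 < τ by linarith)] with σ hσ hστ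
  have h₁ := abs_lt.1 (hclose σ hστ.le)
  have h₂ := abs_lt.1 (hclose τ (by linarith))
  rw [Real.dist_eq] at hσ ⊢
  have h₃ := abs_lt.1 hσ
  rw [abs_lt]
  constructor <;> linarith [h₁.1, h₁.2, h₂.1, h₂.2, h₃.1, h₃.2]

lemma liminf_ofReal_eq_of_sub_log {u G : ℝ → ℝ} {T : ℝ} (hT : 0 < T)
    (hper : Function.Periodic G T)
    (hlim : Tendsto (fun t => u t - G (Real.log t)) atTop (𝓝 0)) {a : ℝ}
    (ha : ∀ τ, G a ≤ G τ) :
    liminf (fun t => ENNReal.ofReal (u t)) atTop = ENNReal.ofReal (G a) := by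
  apply le_antisymm
  · have h : Tendsto (fun n : ℕ => ENNReal.ofReal (u (Real.exp (a + n * T)))) atTop
        (𝓝 (ENNReal.ofReal (G a))) :=
      ENNReal.tendsto_ofReal (tendsto_periodic_of_sub_log hT hper hlim a)
    rw [← h.liminf_eq]
    exact liminf_le_liminf_of_le (u := fun t => ENNReal.ofReal (u t))
      (tendsto_exp_add_mul_atTop hT a)
  · have h : Tendsto (fun t => ENNReal.ofReal (u t - G (Real.log t) + G a)) atTop
        (𝓝 (ENNReal.ofReal (G a))) :=
      ENNReal.tendsto_ofReal (by simpa using hlim.add_const (G a))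
    rw [← h.liminf_eq]
    refine liminf_le_liminf (.of_forall fun t => ENNReal.ofReal_le_ofReal ?_)
    linarith [ha (Real.log t)]

lemma limsup_ofReal_eq_of_sub_log {u G : ℝ → ℝ} {T : ℝ} (hT : 0 < T)
    (hper : Function.Periodic G T)
    (hlim : Tendsto (fun t => u t - G (Real.log t)) atTop (𝓝 0)) {b : ℝ}
    (hb : ∀ τ, G τ ≤ G b) :
    limsup (fun t => ENNReal.ofReal (u t)) atTop = ENNReal.ofReal (G b) := by
  apply le_antisymm
  · have h : Tendsto (fun t => ENNReal.ofReal (u t - G (Real.log t) + G b)) atTop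
        (𝓝 (ENNReal.ofReal (G b))) :=
      ENNReal.tendsto_ofReal (by simpa using hlim.add_const (G b))
    rw [← h.limsup_eq]
    refine limsup_le_limsup (.of_forall fun t => ENNReal.ofReal_le_ofReal ?_)
    linarith [hb (Real.log t)]
  · have h : Tendsto (fun n : ℕ => ENNReal.ofReal (u (Real.exp (b + n * T)))) atTop
        (𝓝 (ENNReal.ofReal (G b))) :=
      ENNReal.tendsto_ofReal (tendsto_periodic_of_sub_log hT hper hlim b)
    rw [← h.limsup_eq]
    exact limsup_le_limsup_of_le (u := fun t => ENNReal.ofReal (u t))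
      (tendsto_exp_add_mul_atTop hT b)

lemma lowerMinkContent_le_upperMinkContent (N : ℕ) (Ω : Set (EuclideanSpace ℝ (Fin N))) (r : ℝ) :
    lowerMinkContent N Ω r ≤ upperMinkContent N Ω r :=
  liminf_le_limsup

lemma lowerMinkContent_antitone (N : ℕ) (Ω : Set (EuclideanSpace ℝ (Fin N))) :
    Antitone (lowerMinkContent N Ω) := by
  intro r s hrs
  refine liminf_le_liminf ?_
  filter_upwards [eventually_ge_atTop 1] with t ht
  gcongr

lemma upperMinkContent_eq_zero_of_lt {N : ℕ} {Ω : Set (EuclideanSpace ℝ (Fin N))} {D r : ℝ}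
    (hD : upperMinkContent N Ω D < ⊤) (hr : D < r) : upperMinkContent N Ω r = 0 := by
  obtain ⟨K, hK, hKtop⟩ := exists_between hD
  have hle : ∀ᶠ t : ℝ in atTop,
      volume (tailSet N Ω t) / ENNReal.ofReal (t ^ ((N : ℝ) + r)) ≤
        K * ENNReal.ofReal (t ^ (-(r - D))) := by
    filter_upwards [eventually_lt_of_limsup_lt hK, eventually_gt_atTop 0] with t hKt ht
    have hpow : (t ^ ((N : ℝ) + r))⁻¹ = (t ^ ((N : ℝ) + D))⁻¹ * t ^ (-(r - D)) := by
      rw [← Real.rpow_neg ht.le, ← Real.rpow_neg ht.le, ← Real.rpow_add ht]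
      ring_nf
    rw [div_eq_mul_inv, ← ENNReal.ofReal_inv_of_pos (Real.rpow_pos_of_pos ht _), hpow,
      ENNReal.ofReal_mul (by positivity), ENNReal.ofReal_inv_of_pos (Real.rpow_pos_of_pos ht _),
      ← mul_assoc, ← div_eq_mul_inv]
    gcongr
  have hzero : Tendsto (fun t : ℝ => K * ENNReal.ofReal (t ^ (-(r - D)))) atTop (𝓝 0) := by
    have h := ENNReal.Tendsto.const_mul (a := K)
      (ENNReal.tendsto_ofReal (tendsto_rpow_neg_atTop (sub_pos.2 hr))) (.inr hKtop.ne)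
    simpa using h
  exact le_antisymm ((limsup_le_limsup hle).trans hzero.limsup_eq.le) bot_le

lemma minkDim_eq_of_nondegenerate {N : ℕ} {Ω : Set (EuclideanSpace ℝ (Fin N))} {D : ℝ}
    (hlow : 0 < lowerMinkContent N Ω D) (hup : upperMinkContent N Ω D < ⊤) :
    lowerMinkDim N Ω = D ∧ upperMinkDim N Ω = D := by
  have hpos : ∀ r ≤ D, 0 < lowerMinkContent N Ω r := fun r hr =>
    hlow.trans_le (lowerMinkContent_antitone N Ω hr)
  have hlower : {r : ℝ | lowerMinkContent N Ω r = 0} = Ioi D := by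
    ext r
    refine ⟨fun h => lt_of_not_ge fun hr => (hpos r hr).ne' h, fun h => ?_⟩
    exact le_antisymm ((lowerMinkContent_le_upperMinkContent N Ω r).trans
      (upperMinkContent_eq_zero_of_lt hup h).le) bot_le
  have hupper : {r : ℝ | upperMinkContent N Ω r = 0} = Ioi D := by
    ext r
    refine ⟨fun h => mem_Ioi.2 (lt_of_not_ge fun hr => ?_),
      fun h => upperMinkContent_eq_zero_of_lt hup h⟩
    exact ((hpos r hr).trans_le (lowerMinkContent_le_upperMinkContent N Ω r)).ne' h
  rw [lowerMinkDim, upperMinkDim, hlower, hupper, csInf_Ioi]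
  exact ⟨rfl, rfl⟩

/-- if `|_tΩ| = t^{N+D}(G(log t) + O(t^{-α}))` with `G` a nonconstant positive
`T`-periodic function and `D < −N`, then `G` is continuous, `dim_B(∞,Ω) = D` exists, `Ω` is
Minkowski nondegenerate but not Minkowski measurable at infinity, with lower/upper contents
`min G`/`max G`, and the range of `G` on `[0,T]` is the whole interval between them. -/
theorem periodic_tube_asymptotics_minkowski_nondegenerate
    (N : ℕ) (Ω : Set (EuclideanSpace ℝ (Fin N)))
    (hmeas : MeasurableSet Ω) (hfin : volume Ω < ⊤)
    (D : ℝ) (hD : D < -(N : ℝ)) (α : ℝ) (hα : 0 < α)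
    (G : ℝ → ℝ) (hGpos : ∀ τ, 0 < G τ)
    (T : ℝ) (hT : 0 < T) (hper : Function.Periodic G T)
    (hnc : ∃ a b : ℝ, G a ≠ G b)
    (hasym : ∃ C > (0 : ℝ), ∃ t₀ > (0 : ℝ), ∀ t : ℝ, t₀ ≤ t →
      |tubeVol N Ω t - t ^ ((N : ℝ) + D) * G (Real.log t)| ≤ C * t ^ ((N : ℝ) + D - α)) :
    Continuous G ∧
    lowerMinkDim N Ω = D ∧ upperMinkDim N Ω = D ∧
    lowerMinkContent N Ω D = ENNReal.ofReal (sInf (Set.range G)) ∧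
    upperMinkContent N Ω D = ENNReal.ofReal (sSup (Set.range G)) ∧
    0 < lowerMinkContent N Ω D ∧ upperMinkContent N Ω D < ⊤ ∧
    lowerMinkContent N Ω D < upperMinkContent N Ω D ∧
    G '' Set.Icc 0 T = Set.Icc (sInf (Set.range G)) (sSup (Set.range G)) := by
  obtain ⟨C, -, t₀, -, hC⟩ := hasym
  set u : ℝ → ℝ := fun t => tubeVol N Ω t / t ^ ((N : ℝ) + D)
  have hlim : Tendsto (fun t => u t - G (Real.log t)) atTop (𝓝 0) := by
    have hbound : Tendsto (fun t : ℝ => C * t ^ (-α)) atTop (𝓝 0) := by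
      simpa using (tendsto_rpow_neg_atTop hα).const_mul C
    refine squeeze_zero_norm' ?_ hbound
    filter_upwards [eventually_ge_atTop t₀, eventually_gt_atTop 0] with t ht ht'
    exact abs_div_rpow_sub_le ht' (hC t ht)
  have hucont : ∀ t, 0 < t → ContinuousAt u t := fun t ht =>
    (tubeVol_continuousAt hfin ht).div
      (Real.continuousAt_rpow_const _ _ (.inl ht.ne')) (Real.rpow_pos_of_pos ht _).ne'
  have hG : Continuous G := continuous_of_periodic_sub_log hT hucont hper hlim
  have himage : G '' Icc 0 T = range G := by simpa using hper.image_Icc hT 0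
  have hcompact : IsCompact (range G) := himage ▸ isCompact_Icc.image hG
  obtain ⟨a, ha⟩ := hcompact.sInf_mem (range_nonempty G)
  obtain ⟨b, hb⟩ := hcompact.sSup_mem (range_nonempty G)
  have hGa : ∀ τ, G a ≤ G τ := fun τ => ha ▸ csInf_le hcompact.bddBelow (mem_range_self τ)
  have hGb : ∀ τ, G τ ≤ G b := fun τ => hb ▸ le_csSup hcompact.bddAbove (mem_range_self τ)
  have hcontent : (fun t : ℝ => volume (tailSet N Ω t) / ENNReal.ofReal (t ^ ((N : ℝ) + D)))
      =ᶠ[atTop] fun t => ENNReal.ofReal (u t) := by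
    filter_upwards [eventually_gt_atTop 0] with t ht using volume_tailSet_div_eq hfin D ht
  have hlower : lowerMinkContent N Ω D = ENNReal.ofReal (G a) :=
    (liminf_congr hcontent).trans (liminf_ofReal_eq_of_sub_log hT hper hlim hGa)
  have hupper : upperMinkContent N Ω D = ENNReal.ofReal (G b) :=
    (limsup_congr hcontent).trans (limsup_ofReal_eq_of_sub_log hT hper hlim hGb)
  have hlow : 0 < lowerMinkContent N Ω D := hlower ▸ ENNReal.ofReal_pos.2 (hGpos a)
  have hup : upperMinkContent N Ω D < ⊤ := hupper ▸ ENNReal.ofReal_lt_top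
  have hab : G a < G b := by
    obtain ⟨x, y, hxy⟩ := hnc
    rcases hxy.lt_or_gt with h | h
    · exact (hGa x).trans_lt (h.trans_le (hGb y))
    · exact (hGa y).trans_lt (h.trans_le (hGb x))
  obtain ⟨hdimlow, hdimup⟩ := minkDim_eq_of_nondegenerate hlow hup
  refine ⟨hG, hdimlow, hdimup, ha ▸ hlower, hb ▸ hupper, hlow, hup, ?_, ?_⟩
  · rw [hlower, hupper]
    exact (ENNReal.ofReal_lt_ofReal_iff (hGpos b)).2 hab
  · rw [← himage]
    exact hG.continuousOn.image_Icc hT.le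
end
end
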